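/- arXiv:2211.01996 — 2 statements merged into one kernel-verified Lean document; each statement's English description precedes it below -/
import Mathlib

section
/- Let k be a field, A a Hopf algebra over k with antipode S, v ∈ M_N(A) a corepresentation matrix, and E ∈ M_N(k) invertible with S(v) = E^{-1} v^T E. If E is symmetric or antisymmetric (E^T = E or E^T = −E), then the element c_V := Σ_{i,j,k,l} S(v_{ji}) ⊗ v_{ik} ⊗ S(v_{kl}) ⊗ v_{lj} + Σ_{i,j} 1 ⊗ v_{ij} ⊗ 1 ⊗ S(v_{ji}) ∈ A^{⊗4} is a Hochschild 3-cycle: b_3(c_V) = 0. -/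
open TensorProduct Matrix

noncomputable section

variable (k A : Type*) [Field k] [Ring A] [HopfAlgebra k A]

/-- Multiply the first two tensor factors of `A ⊗ (A ⊗ M)`. -/
def mulFirst (M : Type*) [AddCommGroup M] [Module k M] :
    A ⊗[k] (A ⊗[k] M) →ₗ[k] A ⊗[k] M :=
  (TensorProduct.map (LinearMap.mul' k A) LinearMap.id) ∘ₗ
    (TensorProduct.assoc k A A M).symm.toLinearMap

/-- `A^{⊗3} ≃ A^{⊗2} ⊗ A`, pulling the last factor out. -/
def pull3 : A ⊗[k] (A ⊗[k] A) ≃ₗ[k] (A ⊗[k] A) ⊗[k] A :=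
  (TensorProduct.assoc k A A A).symm

/-- `A^{⊗4} ≃ A^{⊗3} ⊗ A`, pulling the last factor out. -/
def pull4 : A ⊗[k] (A ⊗[k] (A ⊗[k] A)) ≃ₗ[k] (A ⊗[k] (A ⊗[k] A)) ⊗[k] A :=
  (TensorProduct.congr (LinearEquiv.refl k A) (pull3 k A)).trans
    (TensorProduct.assoc k A (A ⊗[k] A) A).symm

/-- Cyclic rotation `a₀ ⊗ a₁ ⊗ a₂ ⊗ a₃ ↦ a₃ ⊗ a₀ ⊗ a₁ ⊗ a₂` of `A^{⊗4}`. -/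
def rotate4 : A ⊗[k] (A ⊗[k] (A ⊗[k] A)) ≃ₗ[k] A ⊗[k] (A ⊗[k] (A ⊗[k] A)) :=
  (pull4 k A).trans (TensorProduct.comm k (A ⊗[k] (A ⊗[k] A)) A)

/-- The Hochschild boundary `b₃ : A^{⊗4} → A^{⊗3}`,
`a₀⊗a₁⊗a₂⊗a₃ ↦ a₀a₁⊗a₂⊗a₃ - a₀⊗a₁a₂⊗a₃ + a₀⊗a₁⊗a₂a₃ - a₃a₀⊗a₁⊗a₂`. -/
def hochschildB3 : A ⊗[k] (A ⊗[k] (A ⊗[k] A)) →ₗ[k] A ⊗[k] (A ⊗[k] A) :=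
  mulFirst k A (A ⊗[k] A)
  - TensorProduct.map (LinearMap.id : A →ₗ[k] A) (mulFirst k A A)
  + TensorProduct.map (LinearMap.id : A →ₗ[k] A)
      (TensorProduct.map (LinearMap.id : A →ₗ[k] A) (LinearMap.mul' k A))
  - (mulFirst k A (A ⊗[k] A)) ∘ₗ (rotate4 k A).toLinearMap

/-- `b₃` on pure tensors. -/
theorem hochschildB3_tmul (a b c d : A) :
    hochschildB3 k A (a ⊗ₜ[k] (b ⊗ₜ[k] (c ⊗ₜ[k] d)))
      = (a * b) ⊗ₜ[k] (c ⊗ₜ[k] d) - a ⊗ₜ[k] ((b * c) ⊗ₜ[k] d)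
        + a ⊗ₜ[k] (b ⊗ₜ[k] (c * d)) - (d * a) ⊗ₜ[k] (b ⊗ₜ[k] c) := by
  simp [hochschildB3, mulFirst, rotate4, pull4, pull3]

/-- `S(v) v = 1` for a corepresentation matrix `v`. -/
theorem sum_antipode_mul_of_corepresentation {ι : Type*} [Fintype ι] [DecidableEq ι]
    (v : Matrix ι ι A)
    (hΔ : ∀ i j, Coalgebra.comul (R := k) (v i j) = ∑ l, v i l ⊗ₜ[k] v l j)
    (hε : ∀ i j, Coalgebra.counit (R := k) (v i j) = if i = j then 1 else 0) (i j : ι) :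
    ∑ l, HopfAlgebra.antipode k (v i l) * v l j = if i = j then 1 else 0 := by
  have h := HopfAlgebra.mul_antipode_rTensor_comul_apply (R := k) (v i j)
  rw [hΔ, hε] at h
  simpa [apply_ite] using h

/-- `v S(v) = 1` for a corepresentation matrix `v`. -/
theorem sum_mul_antipode_of_corepresentation {ι : Type*} [Fintype ι] [DecidableEq ι]
    (v : Matrix ι ι A)
    (hΔ : ∀ i j, Coalgebra.comul (R := k) (v i j) = ∑ l, v i l ⊗ₜ[k] v l j)
    (hε : ∀ i j, Coalgebra.counit (R := k) (v i j) = if i = j then 1 else 0) (i j : ι) :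
    ∑ l, v i l * HopfAlgebra.antipode k (v l j) = if i = j then 1 else 0 := by
  have h := HopfAlgebra.mul_antipode_lTensor_comul_apply (R := k) (v i j)
  rw [hΔ, hε] at h
  simpa [apply_ite] using h

/-- If `w = E⁻¹ vᵀ E` with `E` symmetric or antisymmetric, then `Σ w_{ji} ⊗ v_{ij}` is
invariant under the flip of `A ⊗ A`. -/
theorem sum_tmul_comm_of_eq_conj_transpose {k A ι : Type*} [Field k] [AddCommGroup A] [Module k A]
    [Fintype ι] [DecidableEq ι] (v w : Matrix ι ι A) (E : Matrix ι ι k)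
    (hw : ∀ l m, w l m = ∑ j, ∑ s, (E⁻¹ l j * E s m) • v s j)
    (hsym : Eᵀ = E ∨ Eᵀ = -E) :
    ∑ i, ∑ j, w j i ⊗ₜ[k] v i j = ∑ i, ∑ j, v i j ⊗ₜ[k] w j i := by
  have hcoef (i j a b : ι) : E⁻¹ j b * E a i = E⁻¹ b j * E i a := by
    rcases hsym with h | h
    · have h' : (E⁻¹)ᵀ = E⁻¹ := by rw [transpose_nonsing_inv, h]
      rw [← transpose_apply E⁻¹ j b, ← transpose_apply E i a, h, h']
    · have h' : (E⁻¹)ᵀ = -E⁻¹ := by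
        rw [transpose_nonsing_inv, h, ← neg_one_smul k E]
        rcases eq_or_ne E.det 0 with h0 | h0
        · have h1 : ¬ IsUnit E.det := by simp [h0]
          have h2 : ¬ IsUnit ((-1 : k) • E).det := by simp [det_neg, h0]
          rw [nonsing_inv_apply_not_isUnit _ h1, nonsing_inv_apply_not_isUnit _ h2, neg_zero]
        · refine inv_eq_left_inv ?_
          simp [nonsing_inv_mul E (isUnit_iff_ne_zero.mpr h0)]
      rw [← transpose_apply E⁻¹ j b, ← transpose_apply E i a, h, h']
      simp
  calc ∑ i, ∑ j, w j i ⊗ₜ[k] v i j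
      = ∑ p : ι × ι, ∑ q : ι × ι, (E⁻¹ p.2 q.2 * E q.1 p.1) • v q.1 q.2 ⊗ₜ[k] v p.1 p.2 := by
        simp only [Fintype.sum_prod_type, hw, TensorProduct.sum_tmul, TensorProduct.smul_tmul']
        exact Finset.sum_congr rfl fun i _ => Finset.sum_congr rfl fun j _ => Finset.sum_comm
    _ = ∑ p : ι × ι, ∑ q : ι × ι, (E⁻¹ q.2 p.2 * E p.1 q.1) • v p.1 p.2 ⊗ₜ[k] v q.1 q.2 :=
        Finset.sum_comm
    _ = ∑ i, ∑ j, v i j ⊗ₜ[k] w j i := by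
        simp only [Fintype.sum_prod_type, hw, TensorProduct.tmul_sum, TensorProduct.tmul_smul]
        refine Finset.sum_congr rfl fun i _ => Finset.sum_congr rfl fun j _ => ?_
        rw [Finset.sum_comm]
        simp only [hcoef]

/-- if `v` is a corepresentation matrix of a Hopf algebra `A` and
`E ∈ Mₙ(k)` is invertible with `S(v) = E⁻¹ vᵀ E` and `E` symmetric or antisymmetric,
then `c_V := Σ S(v_{ji}) ⊗ v_{ik} ⊗ S(v_{kl}) ⊗ v_{lj} + Σ 1 ⊗ v_{ij} ⊗ 1 ⊗ S(v_{ji})`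
is a Hochschild 3-cycle: `b₃(c_V) = 0`. -/
theorem hochschildB3_cV_eq_zero (N : ℕ)
    (v : Matrix (Fin N) (Fin N) A)
    (hΔ : ∀ i j, Coalgebra.comul (R := k) (v i j) = ∑ l, v i l ⊗ₜ[k] v l j)
    (hε : ∀ i j, Coalgebra.counit (R := k) (v i j) = if i = j then 1 else 0)
    (E : Matrix (Fin N) (Fin N) k) (hE : IsUnit E)
    (hSv : ∀ l m, HopfAlgebra.antipode (R := k) (v l m)
      = ∑ j, ∑ s, (E⁻¹ l j * E s m) • v s j)
    (hsym : Eᵀ = E ∨ Eᵀ = -E) :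
    hochschildB3 k A
      ((∑ i, ∑ j, ∑ l, ∑ m, HopfAlgebra.antipode (R := k) (v j i) ⊗ₜ[k]
          (v i l ⊗ₜ[k] (HopfAlgebra.antipode (R := k) (v l m) ⊗ₜ[k] v m j)))
        + ∑ i, ∑ j, (1 : A) ⊗ₜ[k]
            (v i j ⊗ₜ[k] ((1 : A) ⊗ₜ[k] HopfAlgebra.antipode (R := k) (v j i))))
      = 0 := by
  set S := HopfAlgebra.antipode k (A := A)
  have hl := sum_antipode_mul_of_corepresentation k A v hΔ hε
  have hr := sum_mul_antipode_of_corepresentation k A v hΔ hε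
  have hflip := sum_tmul_comm_of_eq_conj_transpose v (v.map S) E hSv hsym
  simp only [map_apply] at hflip
  have h₁ : ∑ i, ∑ j, ∑ l, ∑ m, (S (v j i) * v i l) ⊗ₜ[k] (S (v l m) ⊗ₜ[k] v m j)
      = ∑ i, ∑ j, (1 : A) ⊗ₜ[k] (S (v j i) ⊗ₜ[k] v i j) := by
    calc _ = ∑ j, ∑ l, ∑ m, (∑ i, S (v j i) * v i l) ⊗ₜ[k] (S (v l m) ⊗ₜ[k] v m j) := by
          rw [Finset.sum_comm]
          refine Finset.sum_congr rfl fun j _ => ?_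
          rw [Finset.sum_comm]
          refine Finset.sum_congr rfl fun l _ => ?_
          rw [Finset.sum_comm]
          simp only [TensorProduct.sum_tmul]
      _ = ∑ j, ∑ m, (1 : A) ⊗ₜ[k] (S (v j m) ⊗ₜ[k] v m j) := by
          refine Finset.sum_congr rfl fun j _ => ?_
          rw [Finset.sum_comm]
          simp [S, hl, TensorProduct.ite_tmul]
      _ = _ := Finset.sum_comm
  have h₂ : ∑ i, ∑ j, ∑ l, ∑ m, S (v j i) ⊗ₜ[k] ((v i l * S (v l m)) ⊗ₜ[k] v m j)
      = ∑ i, ∑ j, S (v j i) ⊗ₜ[k] ((1 : A) ⊗ₜ[k] v i j) := by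
    refine Finset.sum_congr rfl fun i _ => Finset.sum_congr rfl fun j _ => ?_
    rw [Finset.sum_comm]
    simp only [← TensorProduct.tmul_sum, ← TensorProduct.sum_tmul, S, hr]
    simp [TensorProduct.ite_tmul]
  have h₃ : ∑ i, ∑ j, ∑ l, ∑ m, S (v j i) ⊗ₜ[k] (v i l ⊗ₜ[k] (S (v l m) * v m j))
      = ∑ i, ∑ j, S (v j i) ⊗ₜ[k] (v i j ⊗ₜ[k] (1 : A)) := by
    refine Finset.sum_congr rfl fun i _ => Finset.sum_congr rfl fun j _ => ?_
    simp only [← TensorProduct.tmul_sum, S, hl]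
    simp [TensorProduct.tmul_ite]
  have h₄ : ∑ i, ∑ j, ∑ l, ∑ m, (v m j * S (v j i)) ⊗ₜ[k] (v i l ⊗ₜ[k] S (v l m))
      = ∑ i, ∑ j, (1 : A) ⊗ₜ[k] (v i j ⊗ₜ[k] S (v j i)) := by
    refine Finset.sum_congr rfl fun i _ => ?_
    rw [Finset.sum_comm]
    refine Finset.sum_congr rfl fun l _ => ?_
    rw [Finset.sum_comm]
    simp only [← TensorProduct.sum_tmul, S, hr]
    simp [TensorProduct.ite_tmul]
  have hone := congrArg (TensorProduct.mk k A (A ⊗[k] A) 1) hflip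
  have hmid := congrArg (TensorProduct.map LinearMap.id (TensorProduct.mk k A A 1)) hflip
  simp only [map_sum, TensorProduct.mk_apply, TensorProduct.map_tmul, LinearMap.id_apply]
    at hone hmid
  simp only [map_add, map_sum, hochschildB3_tmul, Finset.sum_add_distrib,
    Finset.sum_sub_distrib, h₁, h₂, h₃, h₄, one_mul, mul_one, hone, hmid]
  abel

end
end

section
/- Let k be a field, A a Hopf algebra over k with antipode S, v ∈ M_N(A) a corepresentation matrix, and f_1, f_2, f_3 ∈ Hom_k(A,k) primitive elements. Let F_i ∈ M_N(k) be the matrix with entries (F_i)_{pq} = f_i(v_{pq}). Then Σ_{i,j,k,l} S(v_{ji}) (f_1⊳v_{ik}) (f_2⊳S(v_{kl})) (f_3⊳v_{lj}) = − tr(F_1 F_2 F_3) · 1_A, where f⊳a := a_{(1)} f(a_{(2)}). Consequently, the cap product of c_V := Σ_{i,j,k,l} S(v_{ji}) ⊗ v_{ik} ⊗ S(v_{kl}) ⊗ v_{lj} + Σ_{i,j} 1 ⊗ v_{ij} ⊗ 1 ⊗ S(v_{ji}) with the 3-cochain φ(a_1,a_2,a_3) = (f_1⊳a_1)(f_2⊳a_2)(f_3⊳a_3)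 equals − tr(F_1 F_2 F_3) · 1_A. -/
open TensorProduct Matrix

/-- The left action of a functional `f ∈ Hom_k(A,k)` on `A`:
`f ⊳ a := a₍₁₎ f(a₍₂₎) = ((id_A ⊗ f) ∘ Δ)(a)`. -/
noncomputable def functionalAct (k A : Type*) [Field k] [Ring A] [HopfAlgebra k A]
    (f : A →ₗ[k] k) : A →ₗ[k] A :=
  (TensorProduct.rid k A).toLinearMap ∘ₗ
    (TensorProduct.map LinearMap.id f) ∘ₗ (Coalgebra.comul (R := k))

/-- A linear functional `f : A → k` is primitive if
`f(ab) = ε(a) f(b) + f(a) ε(b)` for all `a, b ∈ A`. -/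
def IsPrimitiveFunctional (k A : Type*) [Field k] [Ring A] [HopfAlgebra k A]
    (f : A →ₗ[k] k) : Prop :=
  ∀ a b : A, f (a * b) =
    Coalgebra.counit (R := k) a * f b + f a * Coalgebra.counit (R := k) b

section FunctionalAct

variable {k A : Type*} [Field k] [Ring A] [HopfAlgebra k A]

/-- A primitive functional acts on a Hopf algebra by derivations. -/
theorem IsPrimitiveFunctional.functionalAct_mul {f : A →ₗ[k] k}
    (hf : IsPrimitiveFunctional k A f) (a b : A) :
    functionalAct k A f (a * b) = functionalAct k A f a * b + a * functionalAct k A f b := by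
  have key (X Y : A ⊗[k] A) :
      TensorProduct.rid k A (TensorProduct.map LinearMap.id f (X * Y)) =
        TensorProduct.rid k A (TensorProduct.map LinearMap.id f X) *
            TensorProduct.rid k A (Coalgebra.counit.lTensor A Y) +
          TensorProduct.rid k A (Coalgebra.counit.lTensor A X) *
            TensorProduct.rid k A (TensorProduct.map LinearMap.id f Y) := by
    induction X using TensorProduct.induction_on with
    | zero => simp
    | add X₁ X₂ h₁ h₂ =>
      simp only [add_mul, map_add, h₁, h₂]
      abel
    | tmul a c =>
      induction Y using TensorProduct.induction_on with
      | zero => simp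
      | add Y₁ Y₂ h₁ h₂ =>
        simp only [mul_add, map_add, h₁, h₂]
        abel
      | tmul b d =>
        simp only [Algebra.TensorProduct.tmul_mul_tmul, TensorProduct.map_tmul,
          LinearMap.lTensor_tmul, TensorProduct.rid_tmul, LinearMap.id_coe, id_eq, hf c d,
          smul_mul_smul_comm, add_smul]
        abel
  simpa [functionalAct, Bialgebra.comul_mul] using
    key (Coalgebra.comul (R := k) a) (Coalgebra.comul (R := k) b)

theorem IsPrimitiveFunctional.functionalAct_one {f : A →ₗ[k] k}
    (hf : IsPrimitiveFunctional k A f) : functionalAct k A f 1 = 0 := by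
  simpa using hf.functionalAct_mul 1 1

section Corepresentation

variable {n : Type*} [Fintype n] {v : Matrix n n A}

theorem map_functionalAct_corepresentation
    (hΔ : ∀ i j, Coalgebra.comul (R := k) (v i j) = ∑ l, v i l ⊗ₜ[k] v l j) (f : A →ₗ[k] k) :
    v.map (functionalAct k A f) = v * (v.map f).map (algebraMap k A) := by
  ext i j
  simp [functionalAct, hΔ, Matrix.mul_apply, Algebra.smul_def, Algebra.commutes]

variable [DecidableEq n]

theorem map_antipode_mul_corepresentation
    (hΔ : ∀ i j, Coalgebra.comul (R := k) (v i j) = ∑ l, v i l ⊗ₜ[k] v l j)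
    (hε : ∀ i j, Coalgebra.counit (R := k) (v i j) = if i = j then 1 else 0) :
    v.map (HopfAlgebra.antipode k) * v = 1 := by
  ext i j
  have h := HopfAlgebra.mul_antipode_rTensor_comul_apply (R := k) (v i j)
  rw [hΔ, hε] at h
  simpa [Matrix.mul_apply, Matrix.one_apply, apply_ite (algebraMap k A)] using h

theorem corepresentation_mul_map_antipode
    (hΔ : ∀ i j, Coalgebra.comul (R := k) (v i j) = ∑ l, v i l ⊗ₜ[k] v l j)
    (hε : ∀ i j, Coalgebra.counit (R := k) (v i j) = if i = j then 1 else 0) :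
    v * v.map (HopfAlgebra.antipode k) = 1 := by
  ext i j
  have h := HopfAlgebra.mul_antipode_lTensor_comul_apply (R := k) (v i j)
  rw [hΔ, hε] at h
  simpa [Matrix.mul_apply, Matrix.one_apply, apply_ite (algebraMap k A)] using h

theorem map_functionalAct_map_antipode
    (hΔ : ∀ i j, Coalgebra.comul (R := k) (v i j) = ∑ l, v i l ⊗ₜ[k] v l j)
    (hε : ∀ i j, Coalgebra.counit (R := k) (v i j) = if i = j then 1 else 0)
    {f : A →ₗ[k] k} (hf : IsPrimitiveFunctional k A f) :
    (v.map (HopfAlgebra.antipode k)).map (functionalAct k A f) =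
      -((v.map f).map (algebraMap k A) * v.map (HopfAlgebra.antipode k)) := by
  set w := v.map (HopfAlgebra.antipode k)
  have hwv : w * v = 1 := map_antipode_mul_corepresentation hΔ hε
  have hvw : v * w = 1 := corepresentation_mul_map_antipode hΔ hε
  have leibniz : v.map (functionalAct k A f) * w + v * w.map (functionalAct k A f) = 0 := by
    trans (v * w).map (functionalAct k A f)
    · ext i j
      simp [Matrix.mul_apply, hf.functionalAct_mul, Finset.sum_add_distrib]
    · ext i j
      by_cases h : i = j <;> simp [hvw, h, hf.functionalAct_one]
  calc w.map (functionalAct k A f)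
      = w * (v * w.map (functionalAct k A f)) := by rw [← Matrix.mul_assoc, hwv, Matrix.one_mul]
    _ = -((v.map f).map (algebraMap k A) * w) := by
      rw [eq_neg_of_add_eq_zero_right leibniz, map_functionalAct_corepresentation hΔ,
        Matrix.mul_neg, ← Matrix.mul_assoc, ← Matrix.mul_assoc, hwv, Matrix.one_mul]

end Corepresentation

end FunctionalAct

/-- for a corepresentation matrix `v` of a Hopf algebra `A` and primitive
functionals `f₁, f₂, f₃` with associated matrices `(Fᵢ)ₚq = fᵢ(vₚq)`, one has
`Σ_{i,j,l,m} S(v_{ji}) (f₁⊳v_{il}) (f₂⊳S(v_{lm})) (f₃⊳v_{mj}) = − tr(F₁F₂F₃) · 1_A`;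
consequently the cap product of
`c_V = Σ S(v_{ji}) ⊗ v_{il} ⊗ S(v_{lm}) ⊗ v_{mj} + Σ 1 ⊗ v_{ij} ⊗ 1 ⊗ S(v_{ji})`
with the cochain `φ(a₁,a₂,a₃) = (f₁⊳a₁)(f₂⊳a₂)(f₃⊳a₃)` also equals `− tr(F₁F₂F₃) · 1_A`. -/
theorem cap_product_cV_eq_neg_trace
    (k A : Type*) [Field k] [Ring A] [HopfAlgebra k A]
    (N : ℕ) (v : Matrix (Fin N) (Fin N) A)
    (hΔ : ∀ i j, Coalgebra.comul (R := k) (v i j) = ∑ l, v i l ⊗ₜ[k] v l j)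
    (hε : ∀ i j, Coalgebra.counit (R := k) (v i j) = if i = j then 1 else 0)
    (f₁ f₂ f₃ : A →ₗ[k] k)
    (hf₁ : IsPrimitiveFunctional k A f₁) (hf₂ : IsPrimitiveFunctional k A f₂)
    (hf₃ : IsPrimitiveFunctional k A f₃)
    (F₁ F₂ F₃ : Matrix (Fin N) (Fin N) k)
    (hF₁ : ∀ p q, F₁ p q = f₁ (v p q)) (hF₂ : ∀ p q, F₂ p q = f₂ (v p q))
    (hF₃ : ∀ p q, F₃ p q = f₃ (v p q)) :
    (∑ i, ∑ j, ∑ l, ∑ m,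
        HopfAlgebra.antipode (R := k) (v j i)
          * functionalAct k A f₁ (v i l)
          * functionalAct k A f₂ (HopfAlgebra.antipode (R := k) (v l m))
          * functionalAct k A f₃ (v m j))
      = (- Matrix.trace (F₁ * F₂ * F₃)) • (1 : A)
    ∧
    (∑ i, ∑ j, ∑ l, ∑ m,
        HopfAlgebra.antipode (R := k) (v j i)
          * functionalAct k A f₁ (v i l)
          * functionalAct k A f₂ (HopfAlgebra.antipode (R := k) (v l m))
          * functionalAct k A f₃ (v m j))
      + (∑ i, ∑ j, (1 : A)
          * functionalAct k A f₁ (v i j)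
          * functionalAct k A f₂ (1 : A)
          * functionalAct k A f₃ (HopfAlgebra.antipode (R := k) (v j i)))
      = (- Matrix.trace (F₁ * F₂ * F₃)) • (1 : A) := by
  set w := v.map (HopfAlgebra.antipode k) with hw
  have hwv : w * v = 1 := map_antipode_mul_corepresentation hΔ hε
  have e₁ : v.map f₁ = F₁ := by ext p q; simp [hF₁]
  have e₂ : v.map f₂ = F₂ := by ext p q; simp [hF₂]
  have e₃ : v.map f₃ = F₃ := by ext p q; simp [hF₃]
  have product_eq : w * v.map (functionalAct k A f₁) * w.map (functionalAct k A f₂) *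
      v.map (functionalAct k A f₃) = -(F₁ * F₂ * F₃).map (algebraMap k A) := by
    rw [map_functionalAct_corepresentation hΔ, map_functionalAct_corepresentation hΔ,
      map_functionalAct_map_antipode hΔ hε hf₂, ← hw, e₁, e₂, e₃, ← Matrix.mul_assoc w, hwv,
      Matrix.one_mul, Matrix.mul_neg, Matrix.neg_mul, Matrix.map_mul, Matrix.map_mul]
    simp only [Matrix.mul_assoc]
    rw [← Matrix.mul_assoc w, hwv, Matrix.one_mul]
  have main : (∑ i, ∑ j, ∑ l, ∑ m,
        HopfAlgebra.antipode (R := k) (v j i)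
          * functionalAct k A f₁ (v i l)
          * functionalAct k A f₂ (HopfAlgebra.antipode (R := k) (v l m))
          * functionalAct k A f₃ (v m j))
      = (- Matrix.trace (F₁ * F₂ * F₃)) • (1 : A) := by
    trans Matrix.trace (w * (v.map (functionalAct k A f₁) * (w.map (functionalAct k A f₂) *
      v.map (functionalAct k A f₃))))
    · rw [Finset.sum_comm]
      simp only [Matrix.trace, Matrix.diag, Matrix.mul_apply, Finset.mul_sum, hw,
        Matrix.map_apply, mul_assoc]
    · rw [← Matrix.mul_assoc, ← Matrix.mul_assoc, product_eq, Matrix.trace_neg, neg_smul,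
        ← Algebra.algebraMap_eq_smul_one]
      simp only [Matrix.trace, Matrix.diag, Matrix.map_apply, map_sum]
  refine ⟨main, ?_⟩
  rw [main]
  simp [hf₂.functionalAct_one]
end
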